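/- Let τ ∈ (0,1), 0 < μ₁ ≤ μ₂, and z, z' ∈ ℝⁿ. If Ψ = ∇_z h(z,μ₂) and Ψ' = ∇_z h(z',μ₁), then ‖Ψ' − Ψ‖₂² ≤ (1/(2μ₁²))‖z' − z‖₂² + (n²/2)·((μ₂ − μ₁)/μ₁)². -/

import Mathlib

/-- Huber-type smoothing function: `f(z,μ) = |z|` if `|z| ≥ μ`, else `z²/(2μ) + μ/2`. -/
noncomputable def huber (μ z : ℝ) : ℝ := if μ ≤ |z| then |z| else z^2/(2*μ) + μ/2

/-- Derivative of `z ↦ huber μ z`: `sign z` if `|z| ≥ μ`, else `z/μ`. -/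
noncomputable def huberDeriv (μ z : ℝ) : ℝ := if μ ≤ |z| then Real.sign z else z/μ

/-- `h(z,μ) = (1/2)(Σᵢ f(zᵢ,μ) + (2τ−1) Σᵢ zᵢ)`. -/
noncomputable def hfun (n : ℕ) (τ μ : ℝ) (z : EuclideanSpace ℝ (Fin n)) : ℝ :=
  (1/2) * (∑ i, huber μ (z i) + (2*τ - 1) * ∑ i, z i)

theorem hasDerivAt_max_zero_sq (x : ℝ) :
    HasDerivAt (fun y : ℝ => (max y 0) ^ 2) (2 * max x 0) x := by
  rw [hasDerivAt_iff_isLittleO]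
  refine Asymptotics.IsBigO.trans_isLittleO (g := fun y : ℝ => ‖y - x‖ ^ 2) ?_
    (Asymptotics.isLittleO_pow_sub_sub x one_lt_two)
  refine Asymptotics.IsBigO.of_bound 1 (Filter.Eventually.of_forall fun y => ?_)
  simp only [smul_eq_mul, Real.norm_eq_abs, one_mul, abs_pow, sq_abs]
  rw [abs_le]
  rcases le_total x 0 with hx | hx <;> rcases le_total y 0 with hy | hy <;>
    simp only [hx, hy, max_eq_left, max_eq_right] <;>
    constructor <;> nlinarith [mul_nonneg_of_nonpos_of_nonpos (a := x) (b := y),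
      mul_nonneg_of_nonpos_of_nonpos (a := -x) (b := y),
      mul_nonneg_of_nonpos_of_nonpos (a := x) (b := -y), sq_nonneg x, sq_nonneg y,
      sq_nonneg (x - y)]

theorem huber_eq_max {μ : ℝ} (hμ : 0 < μ) (z : ℝ) :
    huber μ z = (z ^ 2 - (max (z - μ) 0) ^ 2 - (max (-z - μ) 0) ^ 2) / (2 * μ) + μ / 2 := by
  unfold huber
  split_ifs with h
  · rcases le_abs'.mp h with hz | hz
    · rw [abs_of_nonpos (by linarith), max_eq_right (by linarith), max_eq_left (by linarith)]
      field_simp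
      ring
    · rw [abs_of_nonneg (by linarith), max_eq_left (by linarith), max_eq_right (by linarith)]
      field_simp
      ring
  · obtain ⟨h₁, h₂⟩ := abs_lt.mp (not_le.mp h)
    rw [max_eq_right (by linarith), max_eq_right (by linarith)]
    ring

theorem huberDeriv_eq_clamp {μ : ℝ} (hμ : 0 < μ) (z : ℝ) :
    huberDeriv μ z = max (-1) (min 1 (z / μ)) := by
  unfold huberDeriv
  split_ifs with h
  · rcases le_abs'.mp h with hz | hz
    · have : z / μ ≤ -1 := by rw [div_le_iff₀ hμ]; linarith
      rw [Real.sign_of_neg (by linarith), min_eq_right (by linarith), max_eq_left this]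
    · have : 1 ≤ z / μ := by rw [le_div_iff₀ hμ]; linarith
      rw [Real.sign_of_pos (by linarith), min_eq_left this, max_eq_right (by norm_num)]
  · obtain ⟨h₁, h₂⟩ := abs_lt.mp (not_le.mp h)
    have h₃ : -1 ≤ z / μ := by rw [le_div_iff₀ hμ]; linarith
    have h₄ : z / μ ≤ 1 := by rw [div_le_iff₀ hμ]; linarith
    rw [min_eq_right h₄, max_eq_right h₃]

theorem huberDeriv_eq_max {μ : ℝ} (hμ : 0 < μ) (z : ℝ) :
    huberDeriv μ z = (z - max (z - μ) 0 + max (-z - μ) 0) / μ := by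
  unfold huberDeriv
  split_ifs with h
  · rcases le_abs'.mp h with hz | hz
    · rw [Real.sign_of_neg (by linarith), max_eq_right (by linarith), max_eq_left (by linarith)]
      field_simp
      ring
    · rw [Real.sign_of_pos (by linarith), max_eq_left (by linarith), max_eq_right (by linarith)]
      field_simp
      ring
  · obtain ⟨h₁, h₂⟩ := abs_lt.mp (not_le.mp h)
    rw [max_eq_right (by linarith), max_eq_right (by linarith)]
    ring

theorem hasDerivAt_huber {μ : ℝ} (hμ : 0 < μ) (z : ℝ) :
    HasDerivAt (huber μ) (huberDeriv μ z) z := by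
  have h₁ : HasDerivAt (fun y : ℝ => (max (y - μ) 0) ^ 2) (2 * max (z - μ) 0 * 1) z :=
    HasDerivAt.comp (h₂ := fun y : ℝ => (max y 0) ^ 2) z (hasDerivAt_max_zero_sq (z - μ))
      ((hasDerivAt_id' z).sub_const μ)
  have h₂ : HasDerivAt (fun y : ℝ => (max (-y - μ) 0) ^ 2) (2 * max (-z - μ) 0 * -1) z :=
    HasDerivAt.comp (h₂ := fun y : ℝ => (max y 0) ^ 2) z (hasDerivAt_max_zero_sq (-z - μ))
      ((hasDerivAt_id' z).fun_neg.sub_const μ)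
  have h₃ := ((((hasDerivAt_pow 2 z).sub h₁).sub h₂).div_const (2 * μ)).add_const (μ / 2)
  rw [funext (huber_eq_max hμ), huberDeriv_eq_max hμ]
  refine h₃.congr_deriv ?_
  field_simp
  push_cast
  ring

theorem hasGradientAt_hfun (n : ℕ) (τ : ℝ) {μ : ℝ} (hμ : 0 < μ)
    (z : EuclideanSpace ℝ (Fin n)) :
    HasGradientAt (fun v => hfun n τ μ v)
      (WithLp.toLp 2 fun i => (1 / 2) * (huberDeriv μ (z i) + (2 * τ - 1))) z := by
  have hproj (i : Fin n) : HasFDerivAt (fun v : EuclideanSpace ℝ (Fin n) => v i)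
      (EuclideanSpace.proj i : EuclideanSpace ℝ (Fin n) →L[ℝ] ℝ) z :=
    (EuclideanSpace.proj i : EuclideanSpace ℝ (Fin n) →L[ℝ] ℝ).hasFDerivAt
  have hhuber := HasFDerivAt.fun_sum (u := Finset.univ) fun (i : Fin n) _ =>
    (hasDerivAt_huber hμ (z i)).comp_hasFDerivAt z (hproj i)
  have hlin := HasFDerivAt.fun_sum (u := Finset.univ) fun (i : Fin n) _ => hproj i
  rw [hasGradientAt_iff_hasFDerivAt]
  refine ((hhuber.add (hlin.const_mul (2 * τ - 1))).const_mul (1 / 2)).congr_fderiv ?_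
  ext v
  simp only [smul_apply, add_apply,
    sum_apply, smul_eq_mul, PiLp.proj_apply,
    InnerProductSpace.toDual_apply_apply, PiLp.inner_apply, RCLike.inner_apply, conj_trivial,
    Finset.mul_sum, ← Finset.sum_add_distrib]
  exact Finset.sum_congr rfl fun i _ => by ring

theorem abs_clamp_sub_clamp_le (a b : ℝ) :
    |max (-1) (min 1 a) - max (-1) (min 1 b)| ≤ |a - b| := by
  rw [max_comm, max_comm (-1), min_comm, min_comm 1]
  exact (abs_max_sub_max_le_abs _ _ _).trans (by simpa using abs_min_sub_min_le_max a 1 b 1)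

theorem abs_huberDeriv_sub_le {μ : ℝ} (hμ : 0 < μ) (x y : ℝ) :
    |huberDeriv μ x - huberDeriv μ y| ≤ |x - y| / μ := by
  rw [huberDeriv_eq_clamp hμ, huberDeriv_eq_clamp hμ]
  refine (abs_clamp_sub_clamp_le _ _).trans_eq ?_
  rw [← sub_div, abs_div, abs_of_pos hμ]

theorem abs_huberDeriv_sub_huberDeriv_le {μ₁ μ₂ : ℝ} (hμ₁ : 0 < μ₁) (hμ : μ₁ ≤ μ₂) (x : ℝ) :
    |huberDeriv μ₁ x - huberDeriv μ₂ x| ≤ (μ₂ - μ₁) / μ₁ := by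
  have hμ₂ : 0 < μ₂ := hμ₁.trans_le hμ
  rw [huberDeriv_eq_max hμ₁, huberDeriv_eq_max hμ₂, div_sub_div _ _ hμ₁.ne' hμ₂.ne', abs_div,
    abs_of_pos (mul_pos hμ₁ hμ₂), div_le_div_iff₀ (mul_pos hμ₁ hμ₂) hμ₁]
  rw [show (μ₂ - μ₁) * (μ₁ * μ₂) = ((μ₂ - μ₁) * μ₂) * μ₁ by ring]
  refine mul_le_mul_of_nonneg_right ?_ hμ₁.le
  rw [abs_le]
  rcases max_cases (x - μ₁) 0 with ⟨h₁, _⟩ | ⟨h₁, _⟩ <;>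
  rcases max_cases (x - μ₂) 0 with ⟨h₂, _⟩ | ⟨h₂, _⟩ <;>
  rcases max_cases (-x - μ₁) 0 with ⟨h₃, _⟩ | ⟨h₃, _⟩ <;>
  rcases max_cases (-x - μ₂) 0 with ⟨h₄, _⟩ | ⟨h₄, _⟩ <;>
  rw [h₁, h₂, h₃, h₄] <;> constructor <;> nlinarith

theorem sq_half_huberDeriv_sub_le {μ₁ μ₂ : ℝ} (hμ₁ : 0 < μ₁) (hμ : μ₁ ≤ μ₂) (x y : ℝ) :
    ((1 / 2) * (huberDeriv μ₁ y - huberDeriv μ₂ x)) ^ 2 ≤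
      (1 / (2 * μ₁ ^ 2)) * (y - x) ^ 2 + (1 / 2) * ((μ₂ - μ₁) / μ₁) ^ 2 := by
  have h₁ := abs_huberDeriv_sub_le hμ₁ y x
  have h₂ := abs_huberDeriv_sub_huberDeriv_le hμ₁ hμ x
  have h₃ := pow_le_pow_left₀ (abs_nonneg _) h₁ 2
  have h₄ := pow_le_pow_left₀ (abs_nonneg _) h₂ 2
  rw [sq_abs] at h₃ h₄
  rw [div_pow |y - x|, sq_abs] at h₃
  have h₅ : (1 / (2 * μ₁ ^ 2)) * (y - x) ^ 2 = (1 / 2) * ((y - x) ^ 2 / μ₁ ^ 2) := by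
    field_simp
  rw [h₅]
  nlinarith [sq_nonneg ((huberDeriv μ₁ y - huberDeriv μ₁ x) -
    (huberDeriv μ₁ x - huberDeriv μ₂ x))]

/-- for `τ ∈ (0,1)`, `0 < μ₁ ≤ μ₂`, `z, z' ∈ ℝⁿ`, if `Ψ = ∇_z h(z,μ₂)`
and `Ψ' = ∇_z h(z',μ₁)`, then
`‖Ψ' − Ψ‖₂² ≤ (1/(2μ₁²))‖z' − z‖₂² + (n²/2)((μ₂ − μ₁)/μ₁)²`. -/
theorem hfun_gradient_two_point_bound (n : ℕ) (τ : ℝ) (hτ : τ ∈ Set.Ioo (0:ℝ) 1)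
    (μ₁ μ₂ : ℝ) (hμ₁ : 0 < μ₁) (hμ : μ₁ ≤ μ₂)
    (z z' Ψ Ψ' : EuclideanSpace ℝ (Fin n))
    (hΨ : Ψ = gradient (fun v => hfun n τ μ₂ v) z)
    (hΨ' : Ψ' = gradient (fun v => hfun n τ μ₁ v) z') :
    ‖Ψ' - Ψ‖^2 ≤ (1/(2*μ₁^2)) * ‖z' - z‖^2 + (n^2/2) * ((μ₂ - μ₁)/μ₁)^2 := by
  have hμ₂ : 0 < μ₂ := hμ₁.trans_le hμ
  rw [(hasGradientAt_hfun n τ hμ₂ z).gradient] at hΨ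
  rw [(hasGradientAt_hfun n τ hμ₁ z').gradient] at hΨ'
  have hn : (n : ℝ) ≤ (n : ℝ) ^ 2 := by exact_mod_cast Nat.le_self_pow two_ne_zero n
  rw [EuclideanSpace.real_norm_sq_eq, EuclideanSpace.real_norm_sq_eq]
  calc ∑ i, (Ψ' - Ψ) i ^ 2
      ≤ ∑ i, ((1 / (2 * μ₁ ^ 2)) * (z' - z) i ^ 2 + (1 / 2) * ((μ₂ - μ₁) / μ₁) ^ 2) := by
        refine Finset.sum_le_sum fun i _ => ?_
        refine le_of_eq_of_le ?_ (sq_half_huberDeriv_sub_le hμ₁ hμ (z i) (z' i))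
        simp only [hΨ, hΨ', PiLp.sub_apply]
        ring
    _ = (1 / (2 * μ₁ ^ 2)) * ∑ i, (z' - z) i ^ 2 + (n / 2) * ((μ₂ - μ₁) / μ₁) ^ 2 := by
        rw [Finset.sum_add_distrib, ← Finset.mul_sum, Finset.sum_const, Finset.card_univ,
          Fintype.card_fin, nsmul_eq_mul]
        ring
    _ ≤ _ := by gcongr
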